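/- arXiv:math/0311306 — 11 statements merged into one kernel-verified Lean document; each statement's English description precedes it below -/
import Mathlib

section
/- Let F be a finite field of odd characteristic and let Δ ∈ F be nonzero. The commutative group of points {(x,y) ∈ F × F : x² − Δy² = 4}, with group law (r,s) + (t,u) = ((rt + Δsu)/2, (ru + st)/2) and neutral element N = (2,0), is cyclic. -/
/-- The group law on the Pell conic `X² - ΔY² = 4` over a field. -/
def pellAdd {F : Type*} [Field F] (Δ : F) (P Q : F × F) : F × F :=
  ((P.1 * Q.1 + Δ * P.2 * Q.2) / 2, (P.1 * Q.2 + P.2 * Q.1) / 2)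

section PellConic

variable {F K : Type*} [Field F] [Field K] [Algebra F K]

/-- The coordinate `(x + δ y) / 2` on the Pell conic, where `δ` is a square root of `Δ`. -/
def pellCoord (δ : K) (P : F × F) : K :=
  (algebraMap F K P.1 + δ * algebraMap F K P.2) / 2

lemma pellAdd_mem_conic (h2 : (2 : F) ≠ 0) {Δ : F} {P Q : F × F}
    (hP : P.1 ^ 2 - Δ * P.2 ^ 2 = 4) (hQ : Q.1 ^ 2 - Δ * Q.2 ^ 2 = 4) :
    (pellAdd Δ P Q).1 ^ 2 - Δ * (pellAdd Δ P Q).2 ^ 2 = 4 := by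
  have h : (pellAdd Δ P Q).1 ^ 2 - Δ * (pellAdd Δ P Q).2 ^ 2
      = (P.1 ^ 2 - Δ * P.2 ^ 2) * (Q.1 ^ 2 - Δ * Q.2 ^ 2) / 2 ^ 2 := by
    simp only [pellAdd]
    field_simp
    ring
  rw [h, hP, hQ]
  field_simp
  norm_num

lemma pellCoord_neutral (h2 : (2 : K) ≠ 0) (δ : K) :
    pellCoord δ ((2, 0) : F × F) = 1 := by
  have h : algebraMap F K 2 = 2 := map_ofNat _ 2
  simp [pellCoord, h, h2]

lemma pellCoord_pellAdd (h2 : (2 : K) ≠ 0) {Δ : F} {δ : K} (hδ : δ ^ 2 = algebraMap F K Δ)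
    (P Q : F × F) :
    pellCoord δ (pellAdd Δ P Q) = pellCoord δ P * pellCoord δ Q := by
  simp only [pellCoord, pellAdd, map_div₀, map_add, map_mul, map_ofNat, ← hδ]
  field_simp
  ring

lemma pellCoord_mul_conj (h2 : (2 : K) ≠ 0) {Δ : F} {δ : K} (hδ : δ ^ 2 = algebraMap F K Δ)
    {P : F × F} (hP : P.1 ^ 2 - Δ * P.2 ^ 2 = 4) :
    pellCoord δ P * pellCoord δ (P.1, -P.2) = 1 := by
  have h := congrArg (algebraMap F K) hP
  simp only [map_sub, map_mul, map_pow, map_ofNat, ← hδ] at h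
  simp only [pellCoord, map_neg]
  field_simp
  linear_combination h

lemma pellCoord_injOn (h2 : (2 : K) ≠ 0) {Δ : F} {δ : K} (hδ : δ ^ 2 = algebraMap F K Δ)
    (hδ0 : δ ≠ 0) :
    Set.InjOn (pellCoord δ) {P : F × F | P.1 ^ 2 - Δ * P.2 ^ 2 = 4} := by
  intro P hP Q hQ h
  have hP' := pellCoord_mul_conj h2 hδ hP
  have hQ' := pellCoord_mul_conj h2 hδ hQ
  rw [← h] at hQ'
  have h' := mul_left_cancel₀ (left_ne_zero_of_mul_eq_one hP') (hP'.trans hQ'.symm)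
  simp only [pellCoord, map_neg, div_left_inj' h2] at h h'
  refine Prod.ext ((algebraMap F K).injective (mul_left_cancel₀ h2 ?_))
    ((algebraMap F K).injective (mul_left_cancel₀ (mul_ne_zero h2 hδ0) ?_))
  · linear_combination h + h'
  · linear_combination h - h'

/-- The image of the Pell conic under `pellCoord`, as a subgroup of `Kˣ`. -/
def pellSubgroup (hF : (2 : F) ≠ 0) (hK : (2 : K) ≠ 0) {Δ : F} {δ : K}
    (hδ : δ ^ 2 = algebraMap F K Δ) : Subgroup Kˣ where
  carrier := {u | ∃ P : F × F, P.1 ^ 2 - Δ * P.2 ^ 2 = 4 ∧ pellCoord δ P = u}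
  one_mem' := ⟨(2, 0), by norm_num, pellCoord_neutral hK δ⟩
  mul_mem' := by
    rintro u v ⟨P, hP, hu⟩ ⟨Q, hQ, hv⟩
    exact ⟨pellAdd Δ P Q, pellAdd_mem_conic hF hP hQ, by
      rw [pellCoord_pellAdd hK hδ, hu, hv, Units.val_mul]⟩
  inv_mem' := by
    rintro u ⟨P, hP, hu⟩
    refine ⟨(P.1, -P.2), by simpa using hP, Units.eq_inv_of_mul_eq_one_right ?_⟩
    rw [← hu, mul_comm]
    exact pellCoord_mul_conj hK hδ hP

instance [Finite F] (hF : (2 : F) ≠ 0) (hK : (2 : K) ≠ 0) {Δ : F} {δ : K}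
    (hδ : δ ^ 2 = algebraMap F K Δ) : Finite (pellSubgroup hF hK hδ) := by
  have h : (((↑) : Kˣ → K) ⁻¹' Set.range (pellCoord (F := F) δ)).Finite :=
    (Set.finite_range _).preimage Units.val_injective.injOn
  refine (h.subset ?_).to_subtype
  rintro u ⟨P, -, hP⟩
  exact ⟨P, hP⟩

lemma iterate_pellAdd_mem_conic (h2 : (2 : F) ≠ 0) {Δ : F} {g : F × F}
    (hg : g.1 ^ 2 - Δ * g.2 ^ 2 = 4) (n : ℕ) :
    ((pellAdd Δ g)^[n] (2, 0)).1 ^ 2 - Δ * ((pellAdd Δ g)^[n] (2, 0)).2 ^ 2 = 4 := by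
  induction n with
  | zero => norm_num
  | succ n ih =>
    rw [Function.iterate_succ_apply']
    exact pellAdd_mem_conic h2 hg ih

lemma pellCoord_iterate_pellAdd (h2 : (2 : K) ≠ 0) {Δ : F} {δ : K}
    (hδ : δ ^ 2 = algebraMap F K Δ) (g : F × F) (n : ℕ) :
    pellCoord δ ((pellAdd Δ g)^[n] (2, 0)) = pellCoord δ g ^ n := by
  induction n with
  | zero => simpa using pellCoord_neutral h2 δ
  | succ n ih => rw [Function.iterate_succ_apply', pellCoord_pellAdd h2 hδ, ih, pow_succ']

end PellConic

/-- Let `F` be a finite field of odd characteristic and `Δ ∈ F` nonzero. The group of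
points `(x,y) ∈ F × F` with `x² - Δy² = 4`, under the group law
`(r,s) + (t,u) = ((rt + Δsu)/2, (ru + st)/2)` with neutral element `(2,0)`, is cyclic:
there is a point `g` on the conic such that every point on the conic is an iterated
sum of copies of `g` (starting from the neutral element `(2,0)`). -/
theorem pell_conic_cyclic (F : Type*) [Field F] [Fintype F] (hchar : ringChar F ≠ 2)
    (Δ : F) (hΔ : Δ ≠ 0) :
    ∃ g : F × F, g.1 ^ 2 - Δ * g.2 ^ 2 = 4 ∧
      ∀ Q : F × F, Q.1 ^ 2 - Δ * Q.2 ^ 2 = 4 →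
        ∃ n : ℕ, (pellAdd Δ g)^[n] (2, 0) = Q := by
  have hF : (2 : F) ≠ 0 := Ring.two_ne_zero hchar
  have hK : (2 : AlgebraicClosure F) ≠ 0 := by
    rw [← map_ofNat (algebraMap F (AlgebraicClosure F)) 2]
    exact (map_ne_zero _).2 hF
  obtain ⟨δ, hδ⟩ :=
    IsAlgClosed.exists_pow_nat_eq (algebraMap F (AlgebraicClosure F) Δ) two_pos
  have hδ0 : δ ≠ 0 := by
    rintro rfl
    exact hΔ (by simpa using hδ.symm)
  obtain ⟨⟨u, g, hg, hu⟩, hgen⟩ :=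
    IsCyclic.exists_monoid_generator (α := pellSubgroup hF hK hδ)
  refine ⟨g, hg, fun Q hQ ↦ ?_⟩
  let v : (AlgebraicClosure F)ˣ :=
    Units.mkOfMulEqOne _ _ (pellCoord_mul_conj hK hδ hQ)
  obtain ⟨n, hn⟩ := hgen ⟨v, Q, hQ, rfl⟩
  refine ⟨n, pellCoord_injOn hK hδ hδ0 (iterate_pellAdd_mem_conic hF hg n) hQ ?_⟩
  rw [pellCoord_iterate_pellAdd hK hδ, hu]
  exact congrArg
    (fun w : pellSubgroup hF hK hδ ↦ ((w : (AlgebraicClosure F)ˣ) : AlgebraicClosure F)) hn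
end

section
/- Let p be an odd prime, k ≥ 1 an integer, and Δ an integer not divisible by p. Then the number of pairs (x,y) ∈ (ℤ/p^kℤ)² with x² − Δy² = 4 equals p^{k−1}·(p − (Δ/p)), where (Δ/p) is the Legendre symbol. -/
open Finset in
/-- Away from `(-2, 0)`, the points of the Pell conic over a field are parametrized by the slope
of the line joining them to `(-2, 0)`. -/
lemma card_pell_conic_field {F : Type*} [Field F] [Fintype F] [DecidableEq F]
    (hF : ringChar F ≠ 2) (d : F) (hd : d ≠ 0) :
    (#{P : F × F | P.1 ^ 2 - d * P.2 ^ 2 = 4} : ℤ) = Fintype.card F - quadraticChar F d := by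
  have h2 : (2 : F) ≠ 0 := Ring.two_ne_zero hF
  have h4 : (4 : F) ≠ 0 := by
    rw [show (4 : F) = 2 * 2 by norm_num]
    exact mul_ne_zero h2 h2
  have hslope : #{P ∈ ({P : F × F | P.1 ^ 2 - d * P.2 ^ 2 = 4} : Finset (F × F)) | P.1 + 2 ≠ 0}
      = #{t : F | 1 - d * t ^ 2 ≠ 0} := by
    have hden : ∀ P : F × F, P.1 ^ 2 - d * P.2 ^ 2 = 4 → P.1 + 2 ≠ 0 →
        1 - d * (P.2 / (P.1 + 2)) ^ 2 = 4 / (P.1 + 2) := by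
      intro P hP hne
      field_simp
      linear_combination hP
    refine Finset.card_nbij' (fun P => P.2 / (P.1 + 2))
      (fun t => (2 * (1 + d * t ^ 2) / (1 - d * t ^ 2), 4 * t / (1 - d * t ^ 2))) ?_ ?_ ?_ ?_
    · intro P hP
      simp only [coe_filter, mem_filter, mem_univ, true_and, Set.mem_ofPred_eq] at hP ⊢
      rw [hden P hP.1 hP.2]
      exact div_ne_zero h4 hP.2
    · intro t ht
      simp only [coe_filter, mem_filter, mem_univ, true_and, Set.mem_ofPred_eq] at ht ⊢
      constructor
      · field_simp
        ring
      · have : 2 * (1 + d * t ^ 2) / (1 - d * t ^ 2) + 2 = 4 / (1 - d * t ^ 2) := by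
          field_simp
          ring
        rw [this]
        exact div_ne_zero h4 ht
    · intro P hP
      simp only [coe_filter, mem_filter, mem_univ, true_and, Set.mem_ofPred_eq] at hP
      obtain ⟨hP, hne⟩ := hP
      have hx : 1 + d * (P.2 / (P.1 + 2)) ^ 2 = 2 * P.1 / (P.1 + 2) := by
        linear_combination (norm := skip) -hden P hP hne
        field_simp
        ring
      ext
      · simp only [hden P hP hne, hx]
        field_simp
        ring
      · simp only [hden P hP hne]
        field_simp
    · intro t ht
      simp only [coe_filter, mem_univ, true_and, Set.mem_ofPred_eq] at ht
      have : 2 * (1 + d * t ^ 2) / (1 - d * t ^ 2) + 2 = 4 / (1 - d * t ^ 2) := by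
        field_simp
        ring
      simp only [this]
      rw [div_div_div_cancel_right₀ ht, mul_div_cancel_left₀ t h4]
  have hbase : #{P ∈ ({P : F × F | P.1 ^ 2 - d * P.2 ^ 2 = 4} : Finset (F × F)) | ¬ P.1 + 2 ≠ 0}
      = 1 := by
    rw [card_eq_one]
    refine ⟨(-2, 0), ?_⟩
    ext ⟨x, y⟩
    simp only [mem_filter, mem_univ, true_and, not_not, mem_singleton, Prod.mk.injEq]
    constructor
    · rintro ⟨h, hx⟩
      refine ⟨by linear_combination hx, ?_⟩
      have : d * y ^ 2 = 0 := by linear_combination (x - 2) * hx - h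
      simpa [hd] using this
    · rintro ⟨rfl, rfl⟩
      norm_num
  have hroots : (#{t : F | ¬ 1 - d * t ^ 2 ≠ 0} : ℤ) = quadraticChar F d + 1 := by
    have hsqrt := quadraticChar_card_sqrts hF d⁻¹
    have hinv : quadraticChar F d⁻¹ = quadraticChar F d := by
      have h1 : quadraticChar F (d⁻¹ * d ^ 2) = quadraticChar F d⁻¹ * quadraticChar F (d ^ 2) :=
        map_mul _ _ _
      rw [quadraticChar_sq_one' hd, mul_one] at h1
      rw [← h1]
      congr 1
      field_simp
    rw [← hinv, ← hsqrt]
    congr 2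
    ext t
    simp only [mem_filter, mem_univ, true_and, not_not, Set.mem_toFinset, Set.mem_ofPred_eq]
    rw [sub_eq_zero, eq_comm, mul_comm, ← eq_mul_inv_iff_mul_eq₀ hd, one_mul]
  have hP := card_filter_add_card_filter_not
    (s := ({P : F × F | P.1 ^ 2 - d * P.2 ^ 2 = 4} : Finset (F × F))) (fun P => P.1 + 2 ≠ 0)
  have ht := card_filter_add_card_filter_not (s := (univ : Finset F))
    (fun t => 1 - d * t ^ 2 ≠ 0)
  rw [card_univ] at ht
  rw [hslope, hbase] at hP
  rw [← hP, ← ht]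
  push_cast
  rw [hroots]
  ring

section LocalReduction

open Finset

variable {R F : Type*} [CommRing R] [Field F] {π : R →+* F}

lemma sq_injOn_fiber [IsLocalHom π] (h2 : (2 : F) ≠ 0) {a : F} (ha : a ≠ 0) :
    Set.InjOn (fun x : R => x ^ 2) {x | π x = a} := by
  intro x hx y hy hxy
  rw [Set.mem_ofPred_eq] at hx hy
  have hu : IsUnit (x + y) := by
    refine isUnit_of_map_unit π _ (IsUnit.mk0 _ ?_)
    rw [map_add, hx, hy, ← two_mul]
    exact mul_ne_zero h2 ha
  rw [← sub_eq_zero, ← hu.mul_right_eq_zero]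
  simp only at hxy
  linear_combination hxy

variable [Fintype R] [DecidableEq F]

lemma card_fiber_eq_of_surjective (hπ : Function.Surjective π) (a b : F) :
    #{x | π x = a} = #{x | π x = b} :=
  AddMonoidHom.card_fiber_eq_of_mem_range π.toAddMonoidHom (hπ a) (hπ b)

lemma card_fiber_mul_card [Fintype F] (hπ : Function.Surjective π) (a : F) :
    Fintype.card F * #{x | π x = a} = Fintype.card R := by
  have hsum : Fintype.card R = ∑ b : F, #{x | π x = b} :=
    card_eq_sum_card_fiberwise (f := π) (t := univ) (by simp)
  rw [hsum, sum_congr rfl fun b _ => card_fiber_eq_of_surjective hπ b a, sum_const, card_univ,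
    smul_eq_mul]

lemma existsUnique_sq_eq_of_map_eq [IsLocalHom π] (hπ : Function.Surjective π)
    (h2 : (2 : F) ≠ 0) {a : F} (ha : a ≠ 0) {c : R} (hc : π c = a ^ 2) :
    ∃! x, π x = a ∧ x ^ 2 = c := by
  have hmaps : Set.MapsTo (fun x : R => x ^ 2) (({x | π x = a} : Finset R) : Set R)
      (({x | π x = a ^ 2} : Finset R) : Set R) := by
    intro x hx
    simp_all
  have hinj : Set.InjOn (fun x : R => x ^ 2) (({x | π x = a} : Finset R) : Set R) := by
    simpa using sq_injOn_fiber (π := π) h2 ha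
  obtain ⟨x, hx, hxc⟩ := surjOn_of_injOn_of_card_le _ hmaps hinj
    (card_fiber_eq_of_surjective hπ _ _).le (show c ∈ _ by simpa using hc)
  have hx : π x = a := by simpa using hx
  exact ⟨x, ⟨hx, hxc⟩, fun y hy => sq_injOn_fiber h2 ha hy.1 hx (hy.2.trans hxc.symm)⟩

variable [DecidableEq R]

/-- Every point of the Pell conic over the residue field has as many lifts as an element of the
residue field, since one of the two coordinates determines the other. -/
lemma card_pell_conic_fiber [IsLocalHom π] (hπ : Function.Surjective π) (h2 : (2 : F) ≠ 0)
    {d : R} (hd : π d ≠ 0) {Q : F × F} (hQ : Q.1 ^ 2 - π d * Q.2 ^ 2 = 4) :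
    #{P ∈ ({P : R × R | P.1 ^ 2 - d * P.2 ^ 2 = 4} : Finset (R × R)) | Prod.map π π P = Q}
      = #{x | π x = 0} := by
  obtain ⟨a, b⟩ := Q
  simp only at hQ
  by_cases ha : a = 0
  · have hb : b ≠ 0 := by
      rintro rfl
      apply mul_ne_zero h2 h2
      linear_combination -hQ + a * ha
    have hdu : IsUnit d := isUnit_of_map_unit π _ (IsUnit.mk0 _ hd)
    obtain ⟨e, hde⟩ := hdu.exists_right_inv
    have hπe : π d * π e = 1 := by rw [← map_mul, hde, map_one]
    rw [card_fiber_eq_of_surjective hπ 0 a]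
    refine card_bij (fun P _ => P.1) ?_ ?_ ?_
    · simp +contextual [Prod.ext_iff]
    · rintro ⟨x, y⟩ hP ⟨x', y'⟩ hP' (rfl : x = x')
      simp only [mem_filter, mem_univ, true_and, Prod.map_apply, Prod.mk.injEq] at hP hP'
      refine Prod.ext rfl (sq_injOn_fiber h2 hb hP.2.2 hP'.2.2 ?_)
      linear_combination (y' ^ 2 - y ^ 2) * hde + e * (hP'.1 - hP.1)
    · intro x hx
      simp only [mem_filter, mem_univ, true_and] at hx
      obtain ⟨y, ⟨hy, hyc⟩, -⟩ := existsUnique_sq_eq_of_map_eq (c := e * (x ^ 2 - 4)) hπ h2 hb (by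
        rw [map_mul, map_sub, map_pow, hx, map_ofNat]
        linear_combination π e * hQ + b ^ 2 * hπe)
      refine ⟨(x, y), ?_, rfl⟩
      simp only [mem_filter, mem_univ, true_and, Prod.map_apply, Prod.mk.injEq]
      exact ⟨by linear_combination -d * hyc - (x ^ 2 - 4) * hde, hx, hy⟩
  · rw [card_fiber_eq_of_surjective hπ 0 b]
    refine card_bij (fun P _ => P.2) ?_ ?_ ?_
    · simp +contextual [Prod.ext_iff]
    · rintro ⟨x, y⟩ hP ⟨x', y'⟩ hP' (rfl : y = y')
      simp only [mem_filter, mem_univ, true_and, Prod.map_apply, Prod.mk.injEq] at hP hP'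
      refine Prod.ext (sq_injOn_fiber h2 ha hP.2.1 hP'.2.1 ?_) rfl
      linear_combination hP.1 - hP'.1
    · intro y hy
      simp only [mem_filter, mem_univ, true_and] at hy
      obtain ⟨x, ⟨hx, hxc⟩, -⟩ := existsUnique_sq_eq_of_map_eq (c := 4 + d * y ^ 2) hπ h2 ha (by
        rw [map_add, map_mul, map_pow, hy, map_ofNat]
        linear_combination -hQ)
      refine ⟨(x, y), ?_, rfl⟩
      simp only [mem_filter, mem_univ, true_and, Prod.map_apply, Prod.mk.injEq]
      exact ⟨by linear_combination hxc, hx, hy⟩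

lemma card_pell_conic_eq_mul [Fintype F] [IsLocalHom π] (hπ : Function.Surjective π)
    (h2 : (2 : F) ≠ 0) {d : R} (hd : π d ≠ 0) :
    #{P : R × R | P.1 ^ 2 - d * P.2 ^ 2 = 4} =
      #{Q : F × F | Q.1 ^ 2 - π d * Q.2 ^ 2 = 4} * #{x | π x = 0} := by
  rw [card_eq_sum_card_fiberwise (f := Prod.map π π)
      (t := {Q : F × F | Q.1 ^ 2 - π d * Q.2 ^ 2 = 4}),
    sum_congr rfl fun Q hQ => card_pell_conic_fiber hπ h2 hd (by simpa using hQ),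
    sum_const, smul_eq_mul]
  intro P hP
  have hP : P.1 ^ 2 - d * P.2 ^ 2 = 4 := by simpa using hP
  simpa [map_ofNat π 4] using congrArg π hP

end LocalReduction

lemma ZMod.isLocalHom_castHom_pow (p : ℕ) [Fact p.Prime] {k : ℕ} (h : p ∣ p ^ k) :
    IsLocalHom (ZMod.castHom h (ZMod p)) := by
  have : NeZero (p ^ k) := ⟨pow_ne_zero _ (Fact.out : p.Prime).ne_zero⟩
  refine ⟨fun a ha => ?_⟩
  obtain ⟨n, rfl⟩ := ZMod.natCast_zmod_surjective a
  rw [map_natCast, ZMod.isUnit_iff_coprime] at ha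
  rw [ZMod.isUnit_iff_coprime]
  exact ha.pow_right k

/-- Let `p` be an odd prime, `k ≥ 1`, and `Δ` an integer not divisible by `p`. The
number of pairs `(x,y) ∈ (ℤ/p^kℤ)²` with `x² - Δy² = 4` equals `p^(k-1)·(p - (Δ/p))`,
where `(Δ/p)` is the Legendre symbol. -/
theorem pell_conic_card_zmod_pow (p : ℕ) [Fact p.Prime] (hp : p ≠ 2) (k : ℕ) (hk : 1 ≤ k)
    (Δ : ℤ) (hΔ : ¬ (p : ℤ) ∣ Δ) :
    (Nat.card {P : ZMod (p ^ k) × ZMod (p ^ k) //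
        P.1 ^ 2 - (Δ : ZMod (p ^ k)) * P.2 ^ 2 = 4} : ℤ) =
      (p : ℤ) ^ (k - 1) * ((p : ℤ) - legendreSym p Δ) := by
  have hpos : 0 < p := (Fact.out : p.Prime).pos
  have : NeZero (p ^ k) := ⟨pow_ne_zero _ hpos.ne'⟩
  have hdvd : p ∣ p ^ k := dvd_pow_self p (by omega)
  have := ZMod.isLocalHom_castHom_pow p hdvd
  have hsurj := ZMod.castHom_surjective hdvd
  have hchar : ringChar (ZMod p) ≠ 2 := by rwa [ZMod.ringChar_zmod_n]
  have hd : (Δ : ZMod p) ≠ 0 := by rwa [Ne, ZMod.intCast_zmod_eq_zero_iff_dvd]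
  have hker := card_fiber_mul_card hsurj 0
  rw [ZMod.card, ZMod.card] at hker
  have hker' : Finset.card {x | ZMod.castHom hdvd (ZMod p) x = 0} = p ^ (k - 1) := by
    refine Nat.eq_of_mul_eq_mul_left hpos (hker.trans ?_)
    rw [← pow_succ', Nat.sub_add_cancel hk]
  rw [Nat.card_eq_fintype_card, Fintype.card_subtype,
    card_pell_conic_eq_mul hsurj (Ring.two_ne_zero hchar) (by rwa [map_intCast]), hker',
    map_intCast]
  push_cast
  rw [card_pell_conic_field hchar _ hd, ZMod.card, legendreSym, mul_comm]
end

section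
/- Let a, b, c be nonzero rational numbers. If the conic aX² + bY² = c has a rational point, then it has infinitely many rational points, i.e. the set {(x,y) ∈ ℚ × ℚ : ax² + by² = c} is either empty or infinite. -/
open Polynomial in
/-- The zero set of a nonzero polynomial of degree at most two over a field is finite. -/
theorem finite_setOf_quadratic_eq_zero {K : Type*} [Field K] {p q r : K}
    (h : p ≠ 0 ∨ q ≠ 0 ∨ r ≠ 0) : {t : K | p + q * t + r * t ^ 2 = 0}.Finite := by
  have hf : (C p + C q * X + C r * X ^ 2 : K[X]) ≠ 0 := by
    intro h0
    have h₀ := congrArg (coeff · 0) h0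
    have h₁ := congrArg (coeff · 1) h0
    have h₂ := congrArg (coeff · 2) h0
    simp [coeff_X, coeff_C] at h₀ h₁ h₂
    simp_all
  refine (finite_setOfPred_isRoot hf).subset fun t ht => ?_
  simpa [IsRoot] using ht

/-- Let `a, b, c` be nonzero rationals. The set of rational points on the conic
`aX² + bY² = c` is either empty or infinite. -/
theorem conic_rational_points_empty_or_infinite (a b c : ℚ)
    (ha : a ≠ 0) (hb : b ≠ 0) (hc : c ≠ 0) :
    {P : ℚ × ℚ | a * P.1 ^ 2 + b * P.2 ^ 2 = c} = ∅ ∨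
    {P : ℚ × ℚ | a * P.1 ^ 2 + b * P.2 ^ 2 = c}.Infinite := by
  rcases Set.eq_empty_or_nonempty {P : ℚ × ℚ | a * P.1 ^ 2 + b * P.2 ^ 2 = c} with h | ⟨⟨x, y⟩, h⟩
  · exact Or.inl h
  refine Or.inr fun hfin => ?_
  replace h : a * x ^ 2 + b * y ^ 2 = c := h
  have hisotropic : {t : ℚ | a + 0 * t + b * t ^ 2 = 0}.Finite :=
    finite_setOf_quadratic_eq_zero (Or.inl ha)
  have htangent : {t : ℚ | a * x + b * y * t + 0 * t ^ 2 = 0}.Finite := by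
    apply finite_setOf_quadratic_eq_zero
    by_contra! hxy
    have hx : x = 0 := by simpa [ha] using hxy.1
    have hy : y = 0 := by simpa [hb] using hxy.2.1
    exact hc (by simp [← h, hx, hy])
  -- Every other slope `t` is that of a chord joining `(x, y)` to a second point of the conic.
  refine Set.infinite_univ (α := ℚ) (((hfin.image fun P => (P.2 - y) / (P.1 - x)).union
    (hisotropic.union htangent)).subset fun t _ => ?_)
  by_cases h₁ : a + b * t ^ 2 = 0
  · exact Or.inr (Or.inl (by simpa using h₁))
  by_cases h₂ : a * x + b * y * t = 0
  · exact Or.inr (Or.inr (by simpa using h₂))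
  obtain ⟨s, hs⟩ : ∃ s, s = -2 * (a * x + b * y * t) / (a + b * t ^ 2) := ⟨_, rfl⟩
  have hs₀ : s ≠ 0 := by
    rw [hs]
    exact div_ne_zero (mul_ne_zero (by norm_num) h₂) h₁
  rw [eq_div_iff h₁] at hs
  refine Or.inl ⟨(x + s, y + s * t), ?_, ?_⟩
  · show a * (x + s) ^ 2 + b * (y + s * t) ^ 2 = c
    linear_combination h + s * hs
  · simp [hs₀]
end

section
/- Let Δ > 0 be an integer that is not a perfect square. Then the Pell conic X² − ΔY² = 4 has infinitely many integral points: the set {(x,y) ∈ ℤ × ℤ : x² − Δy² = 4} is infinite, and in particular contains a point with y ≠ 0. -/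
/-- Twice a solution of `x² - dy² = 1` is a solution of `x² - dy² = 4`. -/
theorem Pell.Solution₁.two_mul_prop {d : ℤ} (a : Pell.Solution₁ d) :
    (2 * a.x) ^ 2 - d * (2 * a.y) ^ 2 = 4 := by
  linear_combination 4 * a.prop

/-- Let `Δ > 0` be a nonsquare integer. The Pell conic `X² - ΔY² = 4` has infinitely
many integral points, and in particular an integral point with `y ≠ 0`. -/
theorem pell_conic_infinitely_many_integral_points (Δ : ℤ) (hΔ : 0 < Δ)
    (hsq : ¬ IsSquare Δ) :
    {P : ℤ × ℤ | P.1 ^ 2 - Δ * P.2 ^ 2 = 4}.Infinite ∧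
    ∃ P : ℤ × ℤ, P.1 ^ 2 - Δ * P.2 ^ 2 = 4 ∧ P.2 ≠ 0 := by
  obtain ⟨a, ha⟩ := Pell.IsFundamental.exists_of_not_isSquare hΔ hsq
  constructor
  · refine Set.infinite_of_injective_forall_mem
      (f := fun n : ℤ => (2 * (a ^ n).x, 2 * (a ^ n).y)) (fun m n hmn => ?_)
      (fun n => (a ^ n).two_mul_prop)
    exact ha.y_strictMono.injective (mul_left_cancel₀ two_ne_zero (congrArg Prod.snd hmn))
  · exact ⟨(2 * a.x, 2 * a.y), a.two_mul_prop, mul_ne_zero two_ne_zero ha.2.1.ne'⟩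
end

section
/- Let Δ be a squarefree integer with Δ ≠ 0, 1. Then every rational point on the Pell conic X² − ΔY² = 4 has the form (r/n, s/n) with a common denominator: if x, y ∈ ℚ satisfy x² − Δy² = 4, then the denominator of x (in lowest terms) equals the denominator of y (in lowest terms). -/
/-- Let `Δ` be a squarefree integer, `Δ ≠ 0, 1`. Every rational point on the Pell conic
`X² - ΔY² = 4` has the form `(r/n, s/n)`: the denominators (in lowest terms) of the two
coordinates agree. -/
theorem pell_conic_rational_point_common_denominator (Δ : ℤ) (hsf : Squarefree Δ)
    (h0 : Δ ≠ 0) (h1 : Δ ≠ 1) (x y : ℚ) (h : x ^ 2 - (Δ : ℚ) * y ^ 2 = 4) :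
    x.den = y.den := by
  have hx : (x.den : ℚ) ≠ 0 := by exact_mod_cast x.den_nz
  have hy : (y.den : ℚ) ≠ 0 := by exact_mod_cast y.den_nz
  have hcleared : x.num ^ 2 * (y.den : ℤ) ^ 2 - Δ * (y.num ^ 2 * (x.den : ℤ) ^ 2)
      = 4 * ((x.den : ℤ) ^ 2 * (y.den : ℤ) ^ 2) := by
    rw [← Rat.num_div_den x, ← Rat.num_div_den y] at h
    field_simp at h
    have h' : (x.num : ℚ) ^ 2 * (y.den : ℚ) ^ 2 - Δ * ((y.num : ℚ) ^ 2 * (x.den : ℚ) ^ 2)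
        = 4 * ((x.den : ℚ) ^ 2 * (y.den : ℚ) ^ 2) := by linear_combination h
    exact_mod_cast h'
  have hcx : IsCoprime (x.den : ℤ) x.num := (Rat.isCoprime_num_den x).symm
  have hcy : IsCoprime (y.den : ℤ) y.num := (Rat.isCoprime_num_den y).symm
  have hdvd : (x.den : ℤ) ∣ y.den := by
    have hsq : (x.den : ℤ) ^ 2 ∣ x.num ^ 2 * (y.den : ℤ) ^ 2 :=
      ⟨4 * (y.den : ℤ) ^ 2 + Δ * y.num ^ 2, by linear_combination hcleared⟩
    exact (Int.pow_dvd_pow_iff two_ne_zero).1 (hcx.pow.dvd_of_dvd_mul_left hsq)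
  obtain ⟨k, hk⟩ := Int.natCast_dvd_natCast.1 hdvd
  have hsq : (y.den : ℤ) ^ 2 ∣ Δ * (x.den : ℤ) ^ 2 := by
    have hmul : (y.den : ℤ) ^ 2 ∣ y.num ^ 2 * (Δ * (x.den : ℤ) ^ 2) :=
      ⟨x.num ^ 2 - 4 * (x.den : ℤ) ^ 2, by linear_combination -hcleared⟩
    exact hcy.pow.dvd_of_dvd_mul_left hmul
  have hkk : (k : ℤ) * k ∣ Δ := by
    have hx' : (x.den : ℤ) ^ 2 ≠ 0 := by exact_mod_cast pow_ne_zero 2 x.den_nz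
    rw [hk] at hsq
    push_cast at hsq
    rw [show ((x.den : ℤ) * k) ^ 2 = k * k * (x.den : ℤ) ^ 2 by ring] at hsq
    exact (mul_dvd_mul_iff_right hx').1 hsq
  have hk1 : k = 1 := Nat.isUnit_iff.1 (Int.ofNat_isUnit.1 (hsf _ hkk))
  rw [hk, hk1, mul_one]
end

section
/- Let Δ, a, b be integers with ab = Δ, and let r, s be integers with ar² − bs² = 4. Then ar² + bs² is even, and the point (x, y) = ((ar² + bs²)/2, rs) is an integral point on the Pell conic X² − ΔY² = 4; moreover x = 2 + bs² = ar² − 2. Thus every integral point on a first descendant gives rise to an integral point on the Pell conic. -/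
/-- Let `Δ = ab` and let `(r,s)` be an integral point on the first descendant
`aX² - bY² = 4`. Then `ar² + bs²` is even and `((ar² + bs²)/2, rs)` is an integral
point on the Pell conic `X² - ΔY² = 4` whose first coordinate `x` satisfies
`x = 2 + bs² = ar² - 2`. -/
theorem descendant_point_to_pell_point (Δ a b r s : ℤ) (hab : a * b = Δ)
    (h : a * r ^ 2 - b * s ^ 2 = 4) :
    Even (a * r ^ 2 + b * s ^ 2) ∧
    ∃ x : ℤ, 2 * x = a * r ^ 2 + b * s ^ 2 ∧ x ^ 2 - Δ * (r * s) ^ 2 = 4 ∧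
      x = 2 + b * s ^ 2 ∧ x = a * r ^ 2 - 2 := by
  subst hab
  refine ⟨⟨2 + b * s ^ 2, by linear_combination h⟩, 2 + b * s ^ 2, ?_, ?_, rfl, ?_⟩
  · linear_combination -h
  · linear_combination (-(b * s ^ 2)) * h
  · linear_combination -h
end

section
/- Let Δ be a nonzero rational number and let (x₁,y₁), (x₂,y₂) be rational points on the Pell conic X² − ΔY² = 4 with sum (x₃,y₃) = ((x₁x₂ + Δy₁y₂)/2, (x₁y₂ + x₂y₁)/2). If x₁ ≠ −2, x₂ ≠ −2 and x₃ ≠ −2, then the product (x₁ + 2)(x₂ + 2)(x₃ + 2) is the square of a rational number. (This expresses that the Weil map α(x,y) = (x+2)·ℚ^×² is a group homomorphism from C(ℚ) to ℚ^×/ℚ^×².) -/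
/-- Let `Δ ≠ 0` and let `(x₁,y₁)`, `(x₂,y₂)` be rational points on the Pell conic
`X² - ΔY² = 4` with sum `(x₃,y₃) = ((x₁x₂ + Δy₁y₂)/2, (x₁y₂ + x₂y₁)/2)`. If
`x₁, x₂, x₃ ≠ -2`, then `(x₁+2)(x₂+2)(x₃+2)` is a rational square. (The Weil map
`α(x,y) = (x+2)ℚ^×²` is a homomorphism `C(ℚ) → ℚ^×/ℚ^×²`.) -/
theorem weil_map_multiplicative (Δ : ℚ) (hΔ : Δ ≠ 0) (x₁ y₁ x₂ y₂ : ℚ)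
    (h₁ : x₁ ^ 2 - Δ * y₁ ^ 2 = 4) (h₂ : x₂ ^ 2 - Δ * y₂ ^ 2 = 4)
    (hx₁ : x₁ ≠ -2) (hx₂ : x₂ ≠ -2) (hx₃ : (x₁ * x₂ + Δ * y₁ * y₂) / 2 ≠ -2) :
    IsSquare ((x₁ + 2) * (x₂ + 2) * ((x₁ * x₂ + Δ * y₁ * y₂) / 2 + 2)) := by
  refine ⟨x₁ + x₂ + (x₁ * x₂ + Δ * y₁ * y₂) / 2 + 2, ?_⟩
  linear_combination (Δ * y₂ ^ 2 / 4) * h₁ + ((x₁ ^ 2 - 4) / 4) * h₂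
end

section
/- Let Δ and c be nonzero rational numbers and let D be the conic X² − ΔY² = 4c. For any two rational points p = (u₁,v₁) and q = (u₂,v₂) on D, there exists a unique rational point P = (x,y) on the Pell conic C: X² − ΔY² = 4 such that μ(p,P) = q, where μ((u,v),(x,y)) = ((ux + Δvy)/2, (vx + uy)/2). Thus D is a principal homogeneous space for C(ℚ). -/
/-- Let `Δ, c` be nonzero rationals and `D : X² - ΔY² = 4c`. For any two rational
points `p = (u₁,v₁)` and `q = (u₂,v₂)` on `D` there is a unique rational point
`P = (x,y)` on the Pell conic `C : X² - ΔY² = 4` with `μ(p,P) = q`, where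
`μ((u,v),(x,y)) = ((ux + Δvy)/2, (vx + uy)/2)`. Thus `D` is a principal homogeneous
space for `C(ℚ)`. -/
theorem conic_principal_homogeneous_space (Δ c : ℚ) (hΔ : Δ ≠ 0) (hc : c ≠ 0)
    (u₁ v₁ u₂ v₂ : ℚ) (hp : u₁ ^ 2 - Δ * v₁ ^ 2 = 4 * c)
    (hq : u₂ ^ 2 - Δ * v₂ ^ 2 = 4 * c) :
    ∃! P : ℚ × ℚ, P.1 ^ 2 - Δ * P.2 ^ 2 = 4 ∧
      ((u₁ * P.1 + Δ * v₁ * P.2) / 2, (v₁ * P.1 + u₁ * P.2) / 2) = (u₂, v₂) := by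
  refine ⟨((u₁ * u₂ - Δ * v₁ * v₂) / (2 * c), (u₁ * v₂ - v₁ * u₂) / (2 * c)), ⟨?_, ?_⟩, ?_⟩
  · have h : (u₁ * u₂ - Δ * v₁ * v₂) ^ 2 - Δ * (u₁ * v₂ - v₁ * u₂) ^ 2 = 16 * c ^ 2 := by
      linear_combination (u₂ ^ 2 - Δ * v₂ ^ 2) * hp + 4 * c * hq
    field_simp
    linear_combination h
  · ext
    · field_simp
      linear_combination u₂ * hp
    · field_simp
      linear_combination v₂ * hp
  · rintro ⟨x, y⟩ ⟨-, h⟩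
    obtain ⟨h₁, h₂⟩ := Prod.mk.inj h
    ext
    · field_simp
      linear_combination u₁ * h₁ - Δ * v₁ * h₂ - x / 2 * hp
    · field_simp
      linear_combination u₁ * h₂ - v₁ * h₁ - y / 2 * hp
end

section
/- Let Δ > 0 be a real number and let r, s, n be integers with r² − Δs² = 4n². Then ((|r| + |s|·√Δ)/2)² = (|r² − 2n²| + |rs|·√Δ)/2. (This identity shows that the explicit canonical height ĥ(P) = log((|r| + |s|√Δ)/2) of a rational point P = (r/n, s/n) on the Pell conic X² − ΔY² = 4 satisfies ĥ(2P) = 2ĥ(P), since 2P = ((r² − 2n²)/n², rs/n²).) -/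
/-- Let `Δ > 0` be real and `r, s, n` integers with `r² - Δs² = 4n²`. Then
`((|r| + |s|√Δ)/2)² = (|r² - 2n²| + |rs|√Δ)/2`. (This shows that the explicit
canonical height `ĥ(P) = log((|r| + |s|√Δ)/2)` of `P = (r/n, s/n)` on the Pell conic
satisfies `ĥ(2P) = 2ĥ(P)`, since `2P = ((r² - 2n²)/n², rs/n²)`.) -/
theorem canonical_height_doubling_identity (Δ : ℝ) (hΔ : 0 < Δ) (r s n : ℤ)
    (h : (r : ℝ) ^ 2 - Δ * (s : ℝ) ^ 2 = 4 * (n : ℝ) ^ 2) :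
    ((|(r : ℝ)| + |(s : ℝ)| * Real.sqrt Δ) / 2) ^ 2 =
      (|(r : ℝ) ^ 2 - 2 * (n : ℝ) ^ 2| + |(r : ℝ) * (s : ℝ)| * Real.sqrt Δ) / 2 := by
  have hnonneg : 0 ≤ (r : ℝ) ^ 2 - 2 * (n : ℝ) ^ 2 := by
    have := mul_nonneg hΔ.le (sq_nonneg (s : ℝ))
    linarith [sq_nonneg (r : ℝ)]
  rw [abs_of_nonneg hnonneg, abs_mul]
  linear_combination (1 / 4) * sq_abs (r : ℝ) + (Δ / 4) * sq_abs (s : ℝ) +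
    (|(s : ℝ)| ^ 2 / 4) * Real.sq_sqrt hΔ.le - (1 / 4) * h
end

section
/- Let Δ > 0 be an integer and let r, s, n be integers with n ≥ 1, gcd(r,n) = 1 and r² − Δs² = 4n², so that P = (r/n, s/n) is a rational point on the Pell conic X² − ΔY² = 4. Then |log((|r| + |s|√Δ)/2) − log(max(|r|, n))| < log 4; that is, the canonical height ĥ(P) and the naive height H(P) = log max(|r|, n) differ by less than log 4. -/
/-- Let `Δ > 0` be an integer, and `r, s, n` integers with `n ≥ 1`, `gcd(r,n) = 1` and
`r² - Δs² = 4n²`, so that `P = (r/n, s/n)` is a rational point on the Pell conic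
`X² - ΔY² = 4`. Then the canonical height `ĥ(P) = log((|r| + |s|√Δ)/2)` and the naive
height `H(P) = log max(|r|, n)` differ by less than `log 4`. -/
theorem canonical_height_close_to_naive_height (Δ : ℤ) (hΔ : 0 < Δ) (r s n : ℤ)
    (hn : 1 ≤ n) (hg : Int.gcd r n = 1) (h : r ^ 2 - Δ * s ^ 2 = 4 * n ^ 2) :
    |Real.log ((|(r : ℝ)| + |(s : ℝ)| * Real.sqrt (Δ : ℝ)) / 2) -
      Real.log (max |(r : ℝ)| (n : ℝ))| < Real.log 4 := by
  have hn' : (1 : ℝ) ≤ n := by exact_mod_cast hn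
  have hΔ' : (0 : ℝ) < Δ := by exact_mod_cast hΔ
  have hconic : |(r : ℝ)| ^ 2 = (|(s : ℝ)| * √(Δ : ℝ)) ^ 2 + 4 * (n : ℝ) ^ 2 := by
    rw [mul_pow, Real.sq_sqrt hΔ'.le, sq_abs, sq_abs]
    have : (r : ℝ) ^ 2 - Δ * (s : ℝ) ^ 2 = 4 * (n : ℝ) ^ 2 := by exact_mod_cast h
    linarith
  have hy : 0 ≤ |(s : ℝ)| * √(Δ : ℝ) := by positivity
  have hnr : (n : ℝ) ≤ |(r : ℝ)| :=
    pow_le_pow_iff_left₀ (by positivity) (abs_nonneg _) two_ne_zero |>.1 (by nlinarith)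
  have hyr : |(s : ℝ)| * √(Δ : ℝ) ≤ |(r : ℝ)| :=
    pow_le_pow_iff_left₀ (by positivity) (abs_nonneg _) two_ne_zero |>.1 (by nlinarith)
  rw [max_eq_left hnr]
  generalize |(s : ℝ)| * √(Δ : ℝ) = y at *
  generalize |(r : ℝ)| = x at *
  have hx : 0 < x := by linarith
  rw [abs_sub_lt_iff, sub_lt_iff_lt_add, sub_lt_iff_lt_add,
    ← Real.log_mul (by norm_num) hx.ne', ← Real.log_mul (by norm_num) (by positivity)]
  exact ⟨Real.log_lt_log (by positivity) (by linarith), Real.log_lt_log hx (by linarith)⟩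
end

section
/- (Nagell) Let a, b, c be rational numbers and let K be a number field of odd degree over ℚ. If the curve Y² = aX² + bX + c has a K-rational point, i.e. there exist x, y ∈ K with y² = ax² + bx + c, then it has a rational point: there exist x, y ∈ ℚ with y² = ax² + bx + c. -/
open Polynomial in
/-- Evaluating a polynomial at the two square roots `s` and `-s` of `a` gives conjugate values. -/
theorem exists_aeval_eq_add_mul_sqrt {F E : Type*} [CommRing F] [CommRing E] [Algebra F E]
    {a : F} {s : E} (hs : s ^ 2 = algebraMap F E a) (P : F[X]) :
    ∃ u v : F, aeval s P = algebraMap F E u + algebraMap F E v * s ∧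
      aeval (-s) P = algebraMap F E u - algebraMap F E v * s := by
  induction P using Polynomial.induction_on' with
  | add p q hp hq =>
    obtain ⟨u, v, h₁, h₂⟩ := hp
    obtain ⟨u', v', h₃, h₄⟩ := hq
    refine ⟨u + u', v + v', ?_, ?_⟩
    · simp only [map_add, h₁, h₃]; ring
    · simp only [map_add, h₂, h₄]; ring
  | monomial n r =>
    simp only [aeval_monomial]
    induction n with
    | zero => exact ⟨r, 0, by simp, by simp⟩
    | succ n ih =>
      obtain ⟨u, v, h₁, h₂⟩ := ih
      refine ⟨a * v, u, ?_, ?_⟩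
      · rw [pow_succ, ← mul_assoc, h₁, map_mul, ← hs]; ring
      · rw [pow_succ, ← mul_assoc, h₂, map_mul, ← hs]; ring

open Polynomial in
/-- The norm of a value of the form `z² - a y²` is again a value of this form. -/
theorem exists_sq_sub_mul_sq_eq_norm {F K : Type*} [Field F] [Field K] [Algebra F K]
    [FiniteDimensional F K] (a : F) (z y : K) :
    ∃ u v : F, u ^ 2 - a * v ^ 2 = Algebra.norm F (z ^ 2 - algebraMap F K a * y ^ 2) := by
  obtain ⟨s, hs⟩ := IsAlgClosed.exists_pow_nat_eq
    (algebraMap F (AlgebraicClosure F) a) (n := 2) two_pos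
  let B := Module.finBasis F K
  let M := Algebra.leftMulMatrix B
  let P : F[X] := ((M z).map C + (X : F[X]) • (M y).map C).det
  have hP (t : AlgebraicClosure F) : aeval t P =
      ((M z).map (algebraMap F (AlgebraicClosure F)) +
        t • (M y).map (algebraMap F (AlgebraicClosure F))).det := by
    rw [AlgHom.map_det]
    congr 1
    ext i j
    simp only [AlgHom.mapMatrix_apply, Matrix.map_apply, Matrix.add_apply, Matrix.smul_apply,
      smul_eq_mul, map_add, map_mul, aeval_X, aeval_C]
  obtain ⟨u, v, h₁, h₂⟩ := exists_aeval_eq_add_mul_sqrt hs P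
  refine ⟨u, v, (algebraMap F (AlgebraicClosure F)).injective ?_⟩
  have hM : M (z ^ 2 - algebraMap F K a * y ^ 2) = M z * M z - a • (M y * M y) := by
    rw [← Algebra.smul_def, map_sub, map_smul, map_pow, map_pow, pow_two, pow_two]
  have hc : M z * M y = M y * M z := by rw [← map_mul, ← map_mul, mul_comm]
  have hc' := congrArg (fun N => N.map (algebraMap F (AlgebraicClosure F))) hc
  simp only [Matrix.map_mul] at hc'
  calc algebraMap F (AlgebraicClosure F) (u ^ 2 - a * v ^ 2)
      = aeval s P * aeval (-s) P := by
        rw [h₁, h₂, map_sub, map_mul, map_pow, map_pow, ← hs]; ring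
    _ = _ := by
        rw [hP, hP, ← Matrix.det_mul, Algebra.norm_eq_matrix_det B, RingHom.map_det]
        congr 1
        change _ = (M (z ^ 2 - algebraMap F K a * y ^ 2)).map (algebraMap F _)
        rw [hM, Matrix.map_sub _ (map_sub _), Matrix.map_smul' _ _ _ (map_mul _), Matrix.map_mul, Matrix.map_mul,
          ← hs]
        simp only [add_mul, mul_add, neg_smul, mul_neg, smul_mul_assoc, mul_smul_comm, hc',
          smul_add, smul_smul, pow_two]
        abel

/-- In an extension of odd degree, a nonzero element `d` of the base field represented by
`z² - a y²` is already represented by this form over the base field. -/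
theorem exists_sq_sub_mul_sq_eq_of_odd_finrank {F K : Type*} [Field F] [Field K] [Algebra F K]
    (hodd : Odd (Module.finrank F K)) {a d : F} (hd : d ≠ 0) {z y : K}
    (h : z ^ 2 - algebraMap F K a * y ^ 2 = algebraMap F K d) :
    ∃ u v : F, u ^ 2 - a * v ^ 2 = d := by
  have : FiniteDimensional F K := Module.finite_of_finrank_pos hodd.pos
  obtain ⟨u, v, huv⟩ := exists_sq_sub_mul_sq_eq_norm a z y
  obtain ⟨k, hk⟩ := hodd
  rw [h, Algebra.norm_algebraMap, hk] at huv
  refine ⟨u / d ^ k, v / d ^ k, ?_⟩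
  field_simp
  rw [huv]
  ring

/-- (Nagell) Let `a, b, c` be rationals and `K` a number field of odd degree over `ℚ`.
If the conic `Y² = aX² + bX + c` has a `K`-rational point, then it has a rational
point. -/
theorem nagell_odd_degree_point (K : Type*) [Field K] [NumberField K]
    (hodd : Odd (Module.finrank ℚ K)) (a b c : ℚ)
    (h : ∃ x y : K, y ^ 2 = (a : K) * x ^ 2 + (b : K) * x + (c : K)) :
    ∃ x y : ℚ, y ^ 2 = a * x ^ 2 + b * x + c := by
  obtain ⟨x, y, hxy⟩ := h
  by_cases ha : a = 0
  · subst ha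
    by_cases hb : b = 0
    · subst hb
      by_cases hc : c = 0
      · exact ⟨0, 0, by simp [hc]⟩
      · obtain ⟨u, v, huv⟩ := exists_sq_sub_mul_sq_eq_of_odd_finrank hodd (a := 0) hc
          (z := y) (y := 0) (by simpa using hxy)
        exact ⟨0, u, by linarith⟩
    · exact ⟨-c / b, 0, by field_simp; ring⟩
  · by_cases hD : b ^ 2 - 4 * a * c = 0
    · exact ⟨-b / (2 * a), 0, by field_simp; linarith⟩
    · obtain ⟨u, v, huv⟩ := exists_sq_sub_mul_sq_eq_of_odd_finrank hodd (a := a) hD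
        (z := 2 * a * x + b) (y := 2 * y) (by
          simp only [eq_ratCast]
          push_cast
          linear_combination (-4 * (a : K)) * hxy)
      refine ⟨(u - b) / (2 * a), v / 2, ?_⟩
      field_simp
      linear_combination -huv
end
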